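/- arXiv:2104.13234 — 9 statements merged into one kernel-verified Lean document; each statement's English description precedes it below -/
import Mathlib

section
/- Let A, S and S̄ be finite sets with |S| = |S̄|, and let f : A → A, f̄ : S → S̄, λ : A → S, and λ̄ : A → S̄ be maps such that λ̄ ∘ f = f̄ ∘ λ. If both λ and λ̄ are surjective, then the following are equivalent: (1) f is a bijection from A to A; (2) f̄ is a bijection from S to S̄ and f is injective on λ⁻¹(s) for each s ∈ S. -/
/-- **The AGW criterion.** Let `A`, `S`, `S̄` be finite sets with `|S| = |S̄|`, and let
`f : A → A`, `f̄ : S → S̄`, `λ : A → S`, `λ̄ : A → S̄` be maps with `λ̄ ∘ f = f̄ ∘ λ`.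
If `λ` and `λ̄` are surjective, then `f` is a bijection of `A` if and only if
`f̄` is a bijection from `S` to `S̄` and `f` is injective on `λ⁻¹(s)` for each `s ∈ S`. -/
theorem AGW_criterion {A S Sbar : Type*} [Fintype A] [Fintype S] [Fintype Sbar]
    (hcard : Fintype.card S = Fintype.card Sbar)
    (f : A → A) (fbar : S → Sbar) (lam : A → S) (lambar : A → Sbar)
    (hcomm : lambar ∘ f = fbar ∘ lam)
    (hlam : Function.Surjective lam) (hlambar : Function.Surjective lambar) :
    Function.Bijective f ↔
      (Function.Bijective fbar ∧ ∀ s : S, Set.InjOn f {a : A | lam a = s}) := by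
  constructor
  · intro hf
    have hsurj : Function.Surjective (fbar ∘ lam) := hcomm ▸ hlambar.comp hf.surjective
    exact ⟨(Fintype.bijective_iff_surjective_and_card fbar).2 ⟨hsurj.of_comp, hcard⟩,
      fun _ => hf.injective.injOn⟩
  · rintro ⟨hfbar, hinj⟩
    refine Finite.injective_iff_bijective.1 fun a b hab => ?_
    have hlab : lam a = lam b := hfbar.injective <| by
      rw [← Function.comp_apply (f := fbar), ← Function.comp_apply (f := fbar), ← hcomm,
        Function.comp_apply, Function.comp_apply, hab]
    exact hinj (lam b) hlab rfl hab
end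

section
/- Let f, g ∈ F_q[x] be nonzero polynomials. Then the monic greatest common divisor of the linearized q-associates L_f and L_g (as polynomials over F_q) equals the linearized q-associate of the monic greatest common divisor of f and g, i.e., gcd(L_f(x), L_g(x)) = L_{gcd(f,g)}(x). -/
open Polynomial

/-- The linearized `q`-associate of `f ∈ 𝔽_q[x]` as a polynomial over `𝔽_q`:
for `f = Σ aᵢ xⁱ`, `L_f = Σ aᵢ x^(qⁱ)` where `q` is the cardinality of `Fq`. -/
noncomputable def LqPoly {Fq : Type*} [Field Fq] [Fintype Fq] (f : Polynomial Fq) :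
    Polynomial Fq :=
  f.sum fun i a => C a * X ^ (Fintype.card Fq) ^ i

section LqPoly

variable {Fq : Type*} [Field Fq] [Fintype Fq]

/-- `L_f` is obtained by applying `f`, evaluated at the `q`-Frobenius of `𝔽_q[x]`, to `x`. -/
theorem LqPoly_eq_aeval_frobenius (f : Fq[X]) :
    LqPoly f = aeval (FiniteField.frobeniusAlgHom Fq Fq[X]).toLinearMap f X := by
  rw [aeval_endomorphism, LqPoly]
  congr! 3 with i a
  rw [smul_eq_C_mul, Module.End.pow_apply, AlgHom.coe_toLinearMap,
    FiniteField.coe_frobeniusAlgHom, pow_iterate]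

theorem LqPoly_add (f g : Fq[X]) : LqPoly (f + g) = LqPoly f + LqPoly g := by
  simp [LqPoly_eq_aeval_frobenius]

theorem LqPoly_mul (f g : Fq[X]) :
    LqPoly (f * g) = aeval (FiniteField.frobeniusAlgHom Fq Fq[X]).toLinearMap f (LqPoly g) := by
  simp [LqPoly_eq_aeval_frobenius]

theorem dvd_aeval_frobenius (f h : Fq[X]) :
    h ∣ aeval (FiniteField.frobeniusAlgHom Fq Fq[X]).toLinearMap f h := by
  rw [aeval_endomorphism]
  refine Finset.dvd_sum fun i _ => ?_
  beta_reduce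
  rw [smul_eq_C_mul, Module.End.pow_apply, AlgHom.coe_toLinearMap,
    FiniteField.coe_frobeniusAlgHom, pow_iterate]
  exact (dvd_pow_self h (pow_ne_zero i Fintype.card_ne_zero)).mul_left _

theorem LqPoly_dvd_LqPoly {f g : Fq[X]} (h : f ∣ g) : LqPoly f ∣ LqPoly g := by
  obtain ⟨c, rfl⟩ := h
  rw [mul_comm, LqPoly_mul]
  exact dvd_aeval_frobenius c _

theorem LqPoly_monic {f : Fq[X]} (hf : f.Monic) : (LqPoly f).Monic := by
  have hq : 1 < Fintype.card Fq := Fintype.one_lt_card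
  have hlead : LqPoly f = X ^ Fintype.card Fq ^ f.natDegree +
      ∑ i ∈ Finset.range f.natDegree, C (f.coeff i) * X ^ Fintype.card Fq ^ i := by
    rw [LqPoly, sum_over_range _ (by simp), Finset.sum_range_succ, hf.coeff_natDegree, C_1,
      one_mul, add_comm]
  rw [hlead]
  refine monic_X_pow_add ?_
  refine (degree_sum_le _ _).trans_lt ((Finset.sup_lt_iff (WithBot.bot_lt_coe _)).2 ?_)
  intro i hi
  refine (degree_C_mul_X_pow_le _ _).trans_lt ?_
  exact_mod_cast Nat.pow_lt_pow_right hq (Finset.mem_range.1 hi)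

end LqPoly

/-- For nonzero `f, g ∈ 𝔽_q[x]`, the monic gcd of the linearized `q`-associates `L_f` and `L_g`
equals the linearized `q`-associate of the monic gcd of `f` and `g`. -/
theorem gcd_LqPoly {Fq : Type*} [Field Fq] [Fintype Fq] [DecidableEq Fq]
    (f g : Polynomial Fq) (hf : f ≠ 0) (hg : g ≠ 0) :
    gcd (LqPoly f) (LqPoly g) = LqPoly (gcd f g) := by
  have hmonic : (gcd f g).Monic := by
    rw [← normalize_gcd]
    exact monic_normalize fun h => hf ((gcd_eq_zero_iff f g).1 h).1
  refine dvd_antisymm_of_normalize_eq (normalize_gcd _ _)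
    (LqPoly_monic hmonic).normalize_eq_self ?_
    (dvd_gcd (LqPoly_dvd_LqPoly (gcd_dvd_left f g)) (LqPoly_dvd_LqPoly (gcd_dvd_right f g)))
  obtain ⟨a, b, hab⟩ := exists_gcd_eq_mul_add_mul f g
  rw [hab, LqPoly_add]
  exact dvd_add
    ((gcd_dvd_left _ _).trans (LqPoly_dvd_LqPoly (dvd_mul_right f a)))
    ((gcd_dvd_right _ _).trans (LqPoly_dvd_LqPoly (dvd_mul_right g b)))
end

section
/- For a positive integer n and a nonzero polynomial f ∈ F_q[x], the number of solutions y ∈ F_{q^n} of the equation L_f(y) = 0 is exactly q^{deg F}, where F(x) = gcd(f(x), x^n − 1) (the monic gcd in F_q[x]). -/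
open Polynomial

/-- The linearized `q`-associate of `f ∈ 𝔽_q[x]`, evaluated on an extension field:
`L_f(y) = Σ aᵢ y^(qⁱ)` where `q` is the cardinality of `Fq`. -/
noncomputable def Lq {Fq Fqn : Type*} [Field Fq] [Fintype Fq] [Field Fqn] [Algebra Fq Fqn]
    (f : Polynomial Fq) (y : Fqn) : Fqn :=
  f.sum fun i a => algebraMap Fq Fqn a * y ^ (Fintype.card Fq) ^ i

/-- `L_f` is the value of `f` at the `q`-Frobenius endomorphism. -/
lemma aeval_frobenius_apply {Fq Fqn : Type*} [Field Fq] [Fintype Fq] [Field Fqn] [Algebra Fq Fqn]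
    (f : Polynomial Fq) (y : Fqn) :
    aeval (FiniteField.frobeniusAlgHom Fq Fqn).toLinearMap f y = Lq f y := by
  have hpow (i : ℕ) : ((FiniteField.frobeniusAlgHom Fq Fqn).toLinearMap ^ i) y =
      y ^ (Fintype.card Fq) ^ i := by
    induction i with
    | zero => simp
    | succ i ih => simp [pow_succ', ih, ← pow_mul, mul_comm]
  rw [aeval_eq_sum_range, Lq, sum_over_range _ (by simp), LinearMap.sum_apply]
  exact Finset.sum_congr rfl fun i _ => by
    rw [LinearMap.smul_apply, hpow, Algebra.smul_def]

/-- The kernel of `f` evaluated at the Frobenius has dimension at most `deg f`, because `L_f` is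
a nonzero polynomial of degree `q ^ deg f`. -/
lemma finrank_ker_aeval_frobenius_le {Fq Fqn : Type*} [Field Fq] [Fintype Fq] [Field Fqn]
    [Algebra Fq Fqn] [Finite Fqn] {f : Polynomial Fq} (hf : f ≠ 0) :
    Module.finrank Fq
      (LinearMap.ker (aeval (FiniteField.frobeniusAlgHom Fq Fqn).toLinearMap f)) ≤
        f.natDegree := by
  classical
  set q := Fintype.card Fq
  have hq : 1 < q := Fintype.one_lt_card
  let P : Polynomial Fqn :=
    ∑ i ∈ Finset.range (f.natDegree + 1), C (algebraMap Fq Fqn (f.coeff i)) * X ^ q ^ i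
  have hdeg : P.natDegree ≤ q ^ f.natDegree := by
    refine natDegree_sum_le_of_forall_le _ _ fun i hi => (natDegree_C_mul_X_pow_le _ _).trans ?_
    exact Nat.pow_le_pow_right hq.le (Nat.lt_succ_iff.mp (Finset.mem_range.mp hi))
  have hP : P ≠ 0 := by
    intro h
    have hc : P.coeff (q ^ f.natDegree) = algebraMap Fq Fqn f.leadingCoeff := by
      simp [P, finsetSum_coeff, coeff_C_mul, coeff_X_pow, Nat.pow_right_inj hq]
    rw [h, coeff_zero, eq_comm, map_eq_zero, leadingCoeff_eq_zero] at hc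
    exact hf hc
  have hsub : (LinearMap.ker (aeval (FiniteField.frobeniusAlgHom Fq Fqn).toLinearMap f) :
      Set Fqn) ⊆ P.roots.toFinset := by
    intro y hy
    rw [SetLike.mem_coe, LinearMap.mem_ker, aeval_frobenius_apply, Lq,
      sum_over_range _ (by simp)] at hy
    simpa [P, hP, eval_finsetSum] using hy
  have hcard := (Set.ncard_le_ncard hsub (Finset.finite_toSet _)).trans_eq
    (Set.ncard_coe_finset _)
  have hroots := (Multiset.toFinset_card_le P.roots).trans ((card_roots' P).trans hdeg)
  refine (Nat.pow_le_pow_iff_right hq).mp ((Eq.le ?_).trans (hcard.trans hroots))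
  rw [← Nat.card_coe_set_eq]
  have := Module.natCard_eq_pow_finrank (K := Fq)
    (V := LinearMap.ker (aeval (FiniteField.frobeniusAlgHom Fq Fqn).toLinearMap f))
  rw [Nat.card_eq_fintype_card (α := Fq)] at this
  exact this.symm

/-- For a divisor `g` of `xⁿ - 1`, the kernel of `g` evaluated at the Frobenius has dimension
exactly `deg g`. -/
lemma finrank_ker_aeval_frobenius_of_dvd {Fq Fqn : Type*} [Field Fq] [Fintype Fq] [Field Fqn]
    [Algebra Fq Fqn] [Finite Fqn] {g : Polynomial Fq}
    (hg : g ∣ X ^ Module.finrank Fq Fqn - 1) :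
    Module.finrank Fq
      (LinearMap.ker (aeval (FiniteField.frobeniusAlgHom Fq Fqn).toLinearMap g)) =
        g.natDegree := by
  have hpos : 0 < Module.finrank Fq Fqn := Module.finrank_pos
  have hne : (X ^ Module.finrank Fq Fqn - 1 : Polynomial Fq) ≠ 0 := by
    simpa using X_pow_sub_C_ne_zero hpos (1 : Fq)
  obtain ⟨h, hgh⟩ := hg
  have hg0 : g ≠ 0 := by rintro rfl; simp [hgh] at hne
  have hh0 : h ≠ 0 := by rintro rfl; simp [hgh] at hne
  set φ := (FiniteField.frobeniusAlgHom Fq Fqn).toLinearMap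
  have hcomp : aeval φ h ∘ₗ aeval φ g = 0 := by
    rw [← Module.End.mul_eq_comp, ← map_mul, mul_comm, ← hgh,
      ← FiniteField.minpoly_frobeniusAlgHom, minpoly.aeval]
  have hrange := Submodule.finrank_mono (LinearMap.range_le_ker_iff.mpr hcomp)
  have hnull := LinearMap.finrank_range_add_finrank_ker (aeval φ g)
  have hdeg : Module.finrank Fq Fqn = g.natDegree + h.natDegree := by
    rw [← natDegree_mul hg0 hh0, ← hgh, ← C_1, natDegree_X_pow_sub_C]
  have hgle : Module.finrank Fq (LinearMap.ker (aeval φ g)) ≤ g.natDegree :=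
    finrank_ker_aeval_frobenius_le hg0
  have hhle : Module.finrank Fq (LinearMap.ker (aeval φ h)) ≤ h.natDegree :=
    finrank_ker_aeval_frobenius_le hh0
  omega

/-- If `p` annihilates `φ`, then `f` and `gcd f p` evaluated at `φ` have the same kernel. -/
lemma ker_aeval_gcd_of_aeval_eq_zero {K V : Type*} [Field K] [DecidableEq K] [AddCommGroup V]
    [Module K V] (φ : Module.End K V) {p : Polynomial K} (hp : aeval φ p = 0)
    (f : Polynomial K) :
    LinearMap.ker (aeval φ (gcd f p)) = LinearMap.ker (aeval φ f) := by
  obtain ⟨c, hc⟩ := gcd_dvd_left f p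
  obtain ⟨a, b, hab⟩ := exists_gcd_eq_mul_add_mul f p
  ext y
  simp only [LinearMap.mem_ker]
  constructor <;> intro hy
  · rw [hc, mul_comm, map_mul, Module.End.mul_apply, hy, map_zero]
  · rw [hab, mul_comm f, map_add, map_mul, map_mul, hp, zero_mul, add_zero,
      Module.End.mul_apply, hy, map_zero]

/-- For a positive integer `n` and a nonzero `f ∈ 𝔽_q[x]`, the number of solutions
`y ∈ 𝔽_{qⁿ}` of `L_f(y) = 0` is exactly `q^(deg F)`, where `F = gcd(f, xⁿ - 1)`
is the monic gcd in `𝔽_q[x]`. -/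
theorem card_roots_Lq {Fq Fqn : Type*} [Field Fq] [Fintype Fq] [DecidableEq Fq]
    [Field Fqn] [Algebra Fq Fqn]
    {n : ℕ} (hn : 0 < n) (hrank : Module.finrank Fq Fqn = n)
    (f : Polynomial Fq) (hf : f ≠ 0) :
    Nat.card {y : Fqn | Lq f y = 0} =
      Fintype.card Fq ^ (gcd f (X ^ n - 1) : Polynomial Fq).natDegree := by
  subst hrank
  have : Module.Finite Fq Fqn := Module.finite_of_finrank_pos hn
  have : Finite Fqn := Module.finite_of_finite Fq
  set φ := (FiniteField.frobeniusAlgHom Fq Fqn).toLinearMap with hφ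
  have hφn : aeval φ (X ^ Module.finrank Fq Fqn - 1 : Polynomial Fq) = 0 := by
    rw [← FiniteField.minpoly_frobeniusAlgHom, minpoly.aeval]
  have hset : {y : Fqn | Lq f y = 0} = (LinearMap.ker (aeval φ f) : Set Fqn) := by
    ext y
    simp [hφ, aeval_frobenius_apply]
  rw [hset, ← finrank_ker_aeval_frobenius_of_dvd (Fqn := Fqn) (gcd_dvd_right f _),
    ker_aeval_gcd_of_aeval_eq_zero φ hφn, ← Nat.card_eq_fintype_card]
  exact Module.natCard_eq_pow_finrank
end

section
/- Let f, g ∈ F_q[x] with f nonzero, and let V = {v ∈ F_{q^n} : L_f(v) = 0} be the set of roots of L_f in F_{q^n}. Then the map c ↦ L_g(c) is a bijection from V onto V if and only if gcd(f(x), g(x), x^n − 1) = 1 in F_q[x]. -/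
open Polynomial

theorem Lq_eq_aeval_frobenius {Fq Fqn : Type*} [Field Fq] [Fintype Fq] [Field Fqn] [Algebra Fq Fqn]
    (f : Polynomial Fq) (y : Fqn) :
    Lq f y = aeval (FiniteField.frobeniusAlgHom Fq Fqn).toLinearMap f y := by
  have hpow (i : ℕ) : ((FiniteField.frobeniusAlgHom Fq Fqn).toLinearMap ^ i) y =
      y ^ Fintype.card Fq ^ i := by
    induction i with
    | zero => simp
    | succ i ih => simp [pow_succ', ih, pow_mul, pow_right_comm]
  rw [Lq, aeval_eq_sum_range, sum_over_range _ (by simp)]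
  simp [hpow, Algebra.smul_def]

theorem exists_ne_zero_aeval_apply_eq_zero {K V : Type*} [Field K] [AddCommGroup V] [Module K V]
    {φ : Module.End K V} {d : K[X]} (h0 : minpoly K φ ≠ 0) (hd : d ∣ minpoly K φ)
    (hu : ¬ IsUnit d) : ∃ v, v ≠ 0 ∧ aeval φ d v = 0 := by
  obtain ⟨e, he⟩ := hd
  have hde : d * e ≠ 0 := he ▸ h0
  have hφe : aeval φ e ≠ 0 := fun h => by
    obtain ⟨c, hc⟩ := minpoly.dvd K φ h
    refine hu (IsUnit.of_mul_eq_one c (mul_left_cancel₀ (right_ne_zero_of_mul hde) ?_))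
    rw [he] at hc
    linear_combination -hc
  obtain ⟨w, hw⟩ := DFunLike.ne_iff.mp hφe
  refine ⟨aeval φ e w, hw, ?_⟩
  rw [← Module.End.mul_apply, ← map_mul, ← he, minpoly.aeval, LinearMap.zero_apply]

/-- Let `f, g ∈ 𝔽_q[x]` with `f` nonzero and `V = {v ∈ 𝔽_{qⁿ} : L_f(v) = 0}`. Then
`c ↦ L_g(c)` is a bijection from `V` onto `V` iff `gcd(f, g, xⁿ - 1) = 1` in `𝔽_q[x]`. -/
theorem bijOn_Lq_roots_iff {Fq Fqn : Type*} [Field Fq] [Fintype Fq] [DecidableEq Fq]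
    [Field Fqn] [Algebra Fq Fqn]
    {n : ℕ} (hn : 0 < n) (hrank : Module.finrank Fq Fqn = n)
    (f g : Polynomial Fq) (hf : f ≠ 0) :
    Set.BijOn (fun c : Fqn => Lq g c) {v : Fqn | Lq f v = 0} {v : Fqn | Lq f v = 0} ↔
      gcd f (gcd g (X ^ n - 1)) = 1 := by
  have : FiniteDimensional Fq Fqn := Module.finite_of_finrank_pos (hrank ▸ hn)
  have : Finite Fqn := Module.finite_of_finite Fq
  have hmin := FiniteField.minpoly_frobeniusAlgHom Fq Fqn
  rw [hrank] at hmin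
  simp only [Lq_eq_aeval_frobenius]
  set φ := (FiniteField.frobeniusAlgHom Fq Fqn).toLinearMap
  have hann : aeval φ (X ^ n - 1 : Fq[X]) = 0 := hmin ▸ minpoly.aeval Fq φ
  have hcomm (a b : Fq[X]) (v : Fqn) : aeval φ a (aeval φ b v) = aeval φ b (aeval φ a v) := by
    simp only [← Module.End.mul_apply, ← map_mul, mul_comm]
  have hdvd {a b : Fq[X]} (hab : a ∣ b) {v : Fqn} (hv : aeval φ a v = 0) : aeval φ b v = 0 := by
    obtain ⟨c, rfl⟩ := hab
    rw [map_mul, Module.End.mul_apply, hcomm, hv, map_zero]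
  constructor
  · intro h
    by_contra hgcd
    have hu : ¬ IsUnit (gcd f (gcd g (X ^ n - 1))) := fun hu =>
      hgcd (by simpa using normalize_eq_one.mpr hu)
    obtain ⟨v, hv0, hv⟩ := exists_ne_zero_aeval_apply_eq_zero (φ := φ)
      (hmin ▸ X_pow_sub_C_ne_zero hn 1)
      (hmin ▸ (gcd_dvd_right _ _).trans (gcd_dvd_right _ _)) hu
    refine hv0 (h.injOn (hdvd (gcd_dvd_left _ _) hv) (map_zero _) ?_)
    simp [hdvd ((gcd_dvd_right _ _).trans (gcd_dvd_left _ _)) hv]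
  · intro h
    obtain ⟨a, r, hr⟩ := exists_gcd_eq_mul_add_mul f (gcd g (X ^ n - 1))
    obtain ⟨b, c, hbc⟩ := exists_gcd_eq_mul_add_mul g (X ^ n - 1)
    rw [h, hbc] at hr
    have hinv {v : Fqn} (hv : aeval φ f v = 0) : aeval φ g (aeval φ (b * r) v) = v := by
      have hv' := congrArg (fun p => aeval φ p v) hr
      simp only [map_add, map_mul, map_one, hann, zero_mul, add_zero, LinearMap.add_apply,
        Module.End.mul_apply, Module.End.one_apply] at hv'
      rw [hcomm f a v, hv, map_zero, zero_add] at hv'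
      rw [map_mul, Module.End.mul_apply, ← hv']
    have hmaps (k : Fq[X]) {v : Fqn} (hv : aeval φ f v = 0) : aeval φ f (aeval φ k v) = 0 := by
      rw [hcomm, hv, map_zero]
    refine Set.InvOn.bijOn (f' := aeval φ (b * r)) ⟨fun v hv => ?_, fun v hv => hinv hv⟩
      (fun v hv => hmaps g hv) (fun v hv => hmaps (b * r) hv)
    exact (hcomm _ _ _).trans (hinv hv)
end

section
/- Let g, h ∈ F_q[x] with g a divisor of x^n − 1, let f ∈ F_{q^n}[x], and set P(x) = f(L_g(x)) + L_h(x). Suppose that L_g(f(L_g(y))) = 0 for every y ∈ F_{q^n}, i.e., the image of the set L_g(F_{q^n}) under f is contained in the kernel of L_g on F_{q^n}. Then P is a permutation polynomial of F_{q^n} if and only if gcd(x^n − 1, h(x)) = 1 in F_q[x]. -/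
open Polynomial

/-- A polynomial in an endomorphism `φ` is injective iff it is coprime to the minimal polynomial
of `φ`. -/
theorem injective_aeval_iff_isCoprime_minpoly {K V : Type*} [Field K] [AddCommGroup V] [Module K V]
    [FiniteDimensional K V] (φ : Module.End K V) (h : Polynomial K) :
    Function.Injective (aeval φ h) ↔ IsCoprime (minpoly K φ) h := by
  constructor
  · intro hinj
    refine IsRelPrime.isCoprime fun d ⟨e, he⟩ ⟨k, hk⟩ => ?_
    have hd : Function.Injective (aeval φ d) := by
      rw [hk, mul_comm, map_mul, Module.End.mul_eq_comp, LinearMap.coe_comp] at hinj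
      exact hinj.of_comp
    have he0 : aeval φ e = 0 := by
      ext v
      apply hd
      rw [← Module.End.mul_apply, ← map_mul, ← he, minpoly.aeval]
      simp
    have hne : e ≠ 0 := by
      rintro rfl
      exact minpoly.ne_zero (Algebra.IsIntegral.isIntegral φ) (by rw [he, mul_zero])
    obtain ⟨c, hc⟩ := minpoly.dvd K φ he0
    refine .of_mul_eq_one c (mul_right_cancel₀ hne ?_)
    linear_combination -hc - c * he
  · rintro ⟨a, b, hab⟩
    refine Function.LeftInverse.injective (g := aeval φ b) fun v => ?_
    rw [← Module.End.mul_apply, ← map_mul]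
    have := congrArg (aeval φ) hab
    rw [map_add, map_mul, minpoly.aeval, mul_zero, zero_add, map_one] at this
    rw [this, Module.End.one_apply]

/-- If `G` and `H` are commuting endomorphisms of a finite group and `G` kills `F ∘ G`, then
`F ∘ G + H` is bijective iff `H` is injective. -/
theorem bijective_comp_add_iff_injective {A : Type*} [AddCommGroup A] [Finite A] (G H : A →+ A)
    (hcomm : ∀ x, G (H x) = H (G x)) (F : A → A) (hF : ∀ x, G (F (G x)) = 0) :
    Function.Bijective (fun x => F (G x) + H x) ↔ Function.Injective H := by
  have hGP (x : A) : G (F (G x) + H x) = H (G x) := by rw [map_add, hF, zero_add, hcomm]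
  constructor
  · intro hP
    have hsurj : Function.Surjective (fun y : G.range => (⟨H y, by
        obtain ⟨x, hx⟩ := y.2
        exact ⟨H x, by rw [hcomm, hx]⟩⟩ : G.range)) := by
      rintro ⟨_, x, rfl⟩
      obtain ⟨y, hy⟩ := hP.surjective x
      exact ⟨⟨G y, y, rfl⟩, Subtype.ext ((hGP y).symm.trans (congrArg G hy))⟩
    have hinj := Finite.injective_iff_surjective.mpr hsurj
    refine (injective_iff_map_eq_zero H).mpr fun z hz => ?_
    have hGz : G z = 0 := by
      have := @hinj ⟨G z, z, rfl⟩ 0 (Subtype.ext (by simp [← hcomm, hz]))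
      exact congrArg Subtype.val this
    exact hP.injective (by simp [hz, hGz])
  · intro hH
    refine Finite.injective_iff_bijective.mp fun x y hxy => ?_
    have hG : G x = G y := hH (by rw [← hGP, ← hGP]; exact congrArg G hxy)
    exact hH (by simpa [hG] using hxy)

/-- Let `g ∈ 𝔽_q[x]` be a divisor of `xⁿ - 1`, `h ∈ 𝔽_q[x]`, `f ∈ 𝔽_{qⁿ}[x]`, and suppose
`L_g(f(L_g(y))) = 0` for every `y ∈ 𝔽_{qⁿ}`. Then `P(x) = f(L_g(x)) + L_h(x)` is a PP of
`𝔽_{qⁿ}` iff `gcd(xⁿ - 1, h) = 1` in `𝔽_q[x]`. -/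
theorem PP_iff_gcd_of_image_in_ker {Fq Fqn : Type*} [Field Fq] [Fintype Fq] [DecidableEq Fq]
    [Field Fqn] [Algebra Fq Fqn]
    {n : ℕ} (hn : 0 < n) (hrank : Module.finrank Fq Fqn = n)
    (g h : Polynomial Fq) (hgdvd : g ∣ X ^ n - 1)
    (f : Polynomial Fqn)
    (hker : ∀ y : Fqn, Lq g (f.eval (Lq g y)) = 0) :
    Function.Bijective (fun c : Fqn => f.eval (Lq g c) + Lq h c) ↔
      gcd (X ^ n - 1 : Polynomial Fq) h = 1 := by
  have : FiniteDimensional Fq Fqn := Module.finite_of_finrank_pos (hrank ▸ hn)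
  have : Finite Fqn := Module.finite_of_finite Fq
  set φ := (FiniteField.frobeniusAlgHom Fq Fqn).toLinearMap with hφ
  have hgcd : gcd (X ^ n - 1 : Polynomial Fq) h = 1 ↔ IsCoprime (X ^ n - 1) h := by
    rw [← gcd_isUnit_iff, ← normalize_eq_one, normalize_gcd]
  rw [hgcd, ← hrank, ← FiniteField.minpoly_frobeniusAlgHom, ← hφ,
    ← injective_aeval_iff_isCoprime_minpoly]
  simp only [Lq_eq_aeval_frobenius, ← hφ] at hker ⊢
  refine bijective_comp_add_iff_injective (aeval φ g).toAddMonoidHom (aeval φ h).toAddMonoidHom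
    (fun x => ?_) (fun y => f.eval y) hker
  simp only [LinearMap.toAddMonoidHom_coe, ← Module.End.mul_apply, ← map_mul, mul_comm]
end

section
/- Let g, h ∈ F_q[x] be relatively prime polynomials such that g divides x^n − 1 and x^n − 1 divides g·h. Then for every polynomial f ∈ F_{q^n}[x], the polynomial P(x) = f(L_g(x)) + L_h(x) is a permutation polynomial of F_{q^n} if and only if the map y ↦ L_g(f(y)) is a bijection of the set L_g(F_{q^n}) = {L_g(c) : c ∈ F_{q^n}} onto itself. -/
open Polynomial

/-- If `A` and `B` are additive with `A ∘ B = 0` and `ker A ∩ ker B = 0`, then `y ↦ f (A y) + B y`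
is bijective iff `A ∘ f` permutes the range of `A`. -/
theorem bijective_comp_add_iff_bijOn_range {R V : Type*} [Ring R] [AddCommGroup V] [Module R V]
    [Finite V] (A B : Module.End R V) (hAB : A * B = 0) (hker : Disjoint A.ker B.ker)
    (f : V → V) :
    Function.Bijective (fun c => f (A c) + B c) ↔
      Set.BijOn (fun y => A (f y)) (Set.range A) (Set.range A) := by
  have hA (c : V) : A (f (A c) + B c) = A (f (A c)) := by
    rw [map_add, ← Module.End.mul_apply, hAB, LinearMap.zero_apply, add_zero]
  constructor
  · intro hP
    have hmaps : Set.MapsTo (fun y => A (f y)) (Set.range A) (Set.range A) :=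
      fun y _ => ⟨f y, rfl⟩
    have hsurj : Set.SurjOn (fun y => A (f y)) (Set.range A) (Set.range A) := by
      rintro _ ⟨d, rfl⟩
      obtain ⟨c, rfl⟩ := hP.surjective d
      exact ⟨A c, ⟨c, rfl⟩, (hA c).symm⟩
    exact ((Set.toFinite _).surjOn_iff_bijOn_of_mapsTo hmaps).1 hsurj
  · intro hF
    refine Finite.injective_iff_bijective.1 fun c d hcd => ?_
    have hcd' : f (A c) + B c = f (A d) + B d := hcd
    have hAcd : A c = A d := hF.injOn ⟨c, rfl⟩ ⟨d, rfl⟩ (by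
      simpa only [hA] using congrArg A hcd')
    have hBcd : B c = B d := by
      rwa [hAcd, add_right_inj] at hcd'
    refine sub_eq_zero.1 (Submodule.disjoint_def.1 hker _ ?_ ?_) <;> simp [hAcd, hBcd]

/-- Let `g, h ∈ 𝔽_q[x]` be relatively prime with `g ∣ xⁿ - 1` and `xⁿ - 1 ∣ g·h`. Then for
every `f ∈ 𝔽_{qⁿ}[x]`, `P(x) = f(L_g(x)) + L_h(x)` is a PP of `𝔽_{qⁿ}` iff
`y ↦ L_g(f(y))` is a bijection of `L_g(𝔽_{qⁿ})` onto itself. -/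
theorem PP_iff_bijOn_Lg_f {Fq Fqn : Type*} [Field Fq] [Fintype Fq]
    [Field Fqn] [Algebra Fq Fqn]
    {n : ℕ} (hn : 0 < n) (hrank : Module.finrank Fq Fqn = n)
    (g h : Polynomial Fq) (hcop : IsCoprime g h)
    (hgdvd : g ∣ X ^ n - 1) (hdvdgh : (X ^ n - 1 : Polynomial Fq) ∣ g * h)
    (f : Polynomial Fqn) :
    Function.Bijective (fun c : Fqn => f.eval (Lq g c) + Lq h c) ↔
      Set.BijOn (fun y : Fqn => Lq g (f.eval y))
        (Set.range fun c : Fqn => Lq g c) (Set.range fun c : Fqn => Lq g c) := by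
  subst hrank
  have : Module.Finite Fq Fqn := Module.finite_of_finrank_pos hn
  have : Finite Fqn := Module.finite_of_finite Fq
  simp only [Lq_eq_aeval_frobenius]
  refine bijective_comp_add_iff_bijOn_range _ _ ?_
    (disjoint_ker_aeval_of_isCoprime _ hcop) (fun y => f.eval y)
  obtain ⟨k, hk⟩ := hdvdgh
  rw [← map_mul, hk, map_mul,
    ← FiniteField.minpoly_frobeniusAlgHom, minpoly.aeval, zero_mul]
end

section
/- Let g, h ∈ F_q[x] be relatively prime polynomials such that g divides x^n − 1 and x^n − 1 divides g·h, and let f ∈ F_{q^n}[x] satisfy f(L_g(F_{q^n})) ⊆ L_g(F_{q^n}). Then P(x) = f(L_g(x)) + L_h(x) is a permutation polynomial of F_{q^n} if and only if the map y ↦ f(y) is a bijection of the set L_g(F_{q^n}) = {L_g(c) : c ∈ F_{q^n}} onto itself. -/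
open Polynomial

/-- If `L` and `M` annihilate each other and satisfy the Bézout identity `A * L + B * M = 1`, then
`c ↦ φ (L c) + M c` is bijective iff `φ` permutes the range of `L`. -/
theorem bijective_comp_add_iff_bijOn_range_s8 {R V : Type*} [Ring R] [AddCommGroup V] [Module R V]
    {L M A B : Module.End R V} (hLM : L * M = 0) (hML : M * L = 0) (hbez : A * L + B * M = 1)
    (hA : Commute A L) (hB : Commute B M) {φ : V → V}
    (hφ : Set.MapsTo φ (Set.range L) (Set.range L)) :
    Function.Bijective (fun c => φ (L c) + M c) ↔ Set.BijOn φ (Set.range L) (Set.range L) := by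
  have lm x : L (M x) = 0 := LinearMap.congr_fun hLM x
  have ml x : M (L x) = 0 := LinearMap.congr_fun hML x
  have bez x : A (L x) + B (M x) = x := LinearMap.congr_fun hbez x
  have al x : A (L x) = L (A x) := LinearMap.congr_fun hA.eq x
  have bm x : B (M x) = M (B x) := LinearMap.congr_fun hB.eq x
  have lal x : L (A (L x)) = L x := by simpa [bm, lm] using congrArg L (bez x)
  have mbm x : M (B (M x)) = M x := by simpa [al, ml] using congrArg M (bez x)
  have range_disjoint {x y} (hxy : L x = M y) : L x = 0 := by
    have key := bez (L x)
    rw [ml, hxy, lm] at key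
    simpa [hxy] using key.symm
  refine ⟨fun hP => ⟨hφ, ?_, ?_⟩, fun hbij => ⟨?_, ?_⟩⟩
  · rintro _ ⟨c, rfl⟩ _ ⟨d, rfl⟩ hcd
    have key : A (L c) = A (L d) := hP.injective <| by
      have mal x : M (A (L x)) = 0 := by rw [al, ml]
      simpa [lal, mal] using hcd
    simpa [lal] using congrArg L key
  · rintro _ ⟨a, rfl⟩
    obtain ⟨c, hc⟩ := hP.surjective (L a)
    obtain ⟨b, hb⟩ := hφ ⟨c, rfl⟩
    have key : L (a - b) = M c := by rw [map_sub, hb, ← hc]; simp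
    have hab := range_disjoint key
    rw [map_sub, sub_eq_zero] at hab
    exact ⟨L c, ⟨c, rfl⟩, hb.symm.trans hab.symm⟩
  · intro c d hcd
    obtain ⟨a, ha⟩ := hφ ⟨c, rfl⟩
    obtain ⟨b, hb⟩ := hφ ⟨d, rfl⟩
    have hsum : L a + M c = L b + M d := by simpa [ha, hb] using hcd
    have key : L (a - b) = M (d - c) := by
      rw [map_sub, map_sub, sub_eq_sub_iff_add_eq_add, hsum, add_comm]
    have hab := range_disjoint key
    have hdc := key.symm.trans hab
    rw [map_sub, sub_eq_zero] at hab hdc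
    have hL : L c = L d := hbij.injOn ⟨c, rfl⟩ ⟨d, rfl⟩ (by rw [← ha, ← hb, hab])
    rw [← bez c, ← bez d, hL, hdc]
  · intro w
    obtain ⟨_, ⟨a, rfl⟩, ha⟩ := hbij.surjOn ⟨A w, rfl⟩
    refine ⟨A (L a) + B (M (B w)), ?_⟩
    have hLc : L (A (L a) + B (M (B w))) = L a := by rw [map_add, lal, bm, lm, add_zero]
    have hMc : M (A (L a) + B (M (B w))) = M (B w) := by rw [map_add, mbm, al, ml, zero_add]
    simp only [hLc, hMc, ha]
    rw [← al, ← bm, bez]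

/-- Let `g, h ∈ 𝔽_q[x]` be relatively prime with `g ∣ xⁿ - 1` and `xⁿ - 1 ∣ g·h`, and let
`f ∈ 𝔽_{qⁿ}[x]` satisfy `f(L_g(𝔽_{qⁿ})) ⊆ L_g(𝔽_{qⁿ})`. Then `P(x) = f(L_g(x)) + L_h(x)`
is a PP of `𝔽_{qⁿ}` iff `f` is a bijection of `L_g(𝔽_{qⁿ})` onto itself. -/
theorem PP_iff_bijOn_f {Fq Fqn : Type*} [Field Fq] [Fintype Fq]
    [Field Fqn] [Algebra Fq Fqn]
    {n : ℕ} (hn : 0 < n) (hrank : Module.finrank Fq Fqn = n)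
    (g h : Polynomial Fq) (hcop : IsCoprime g h)
    (hgdvd : g ∣ X ^ n - 1) (hdvdgh : (X ^ n - 1 : Polynomial Fq) ∣ g * h)
    (f : Polynomial Fqn)
    (hmaps : ∀ y ∈ Set.range (fun c : Fqn => Lq g c),
      f.eval y ∈ Set.range (fun c : Fqn => Lq g c)) :
    Function.Bijective (fun c : Fqn => f.eval (Lq g c) + Lq h c) ↔
      Set.BijOn (fun y : Fqn => f.eval y)
        (Set.range fun c : Fqn => Lq g c) (Set.range fun c : Fqn => Lq g c) := by
  have : Module.Finite Fq Fqn := Module.finite_of_finrank_pos (hrank ▸ hn)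
  have : Finite Fqn := Module.finite_of_finite Fq
  set T := (FiniteField.frobeniusAlgHom Fq Fqn).toLinearMap
  have hgh : aeval T (g * h) = 0 :=
    aeval_eq_zero_of_dvd_aeval_eq_zero hdvdgh
      (by rw [← hrank, ← FiniteField.minpoly_frobeniusAlgHom, minpoly.aeval])
  obtain ⟨a, b, hab⟩ := hcop
  simp only [Lq_eq_aeval_frobenius] at hmaps ⊢
  exact bijective_comp_add_iff_bijOn_range_s8 (A := aeval T a) (B := aeval T b)
    (by rw [← map_mul, hgh]) (by rw [← map_mul, mul_comm, hgh])
    (by rw [← map_mul, ← map_mul, ← map_add, hab, map_one])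
    ((Commute.all a g).map (aeval T)) ((Commute.all b h).map (aeval T)) hmaps
end

section
/- Suppose p divides n. Let h, k ∈ F_q[x] with k(c) ∈ F_q \ {0} for every c ∈ F_q and gcd(h(x), x^n − 1) = 1 in F_q[x], let f ∈ F_{q^n}[x], and suppose P(x) = f(Tr_{q^n/q}(x)) + k(Tr_{q^n/q}(x))·L_h(x) is a permutation polynomial of F_{q^n}, so that Q(x) = T_n[f](x) + k(x)·h(1)·x is a permutation polynomial of F_q; let R ∈ F_q[x] be an inverse of Q on F_q (i.e., R(Q(c)) = c for all c ∈ F_q). Let H ∈ F_q[x] be the unique polynomial of degree at most n − 1 with h(x)·H(x) ≡ 1 (mod x^n − 1), and let F ∈ F_{q^n}[x] be any polynomial satisfying F(x) ≡ −k(R(x))^{q−2}·L_H(f(R(x))) (mod x^q − x). Then P_0(x) = F(Tr_{q^n/q}(x)) + k(R(Tr_{q^n/q}(x)))^{q−2}·L_H(x) satisfies P_0(P(a)) = a for every a ∈ F_{q^n}; that is, P_0 is the compositional inverse permutation of P on F_{q^n}. -/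
open Polynomial

/-- `T_n[f](x) = Σ Tr(aᵢ) xⁱ ∈ 𝔽_q[x]` for `f = Σ aᵢ xⁱ ∈ 𝔽_{qⁿ}[x]`, where `Tr` is the
field trace from `𝔽_{qⁿ}` onto `𝔽_q`. -/
noncomputable def Tn (Fq : Type*) {Fqn : Type*} [Field Fq] [Field Fqn] [Algebra Fq Fqn]
    (f : Polynomial Fqn) : Polynomial Fq :=
  f.sum fun i a => C (Algebra.trace Fq Fqn a) * X ^ i

/-- The linearized `q`-associate of `f ∈ 𝔽_q[x]` as a polynomial over the extension `𝔽_{qⁿ}`. -/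
noncomputable def LqPolyExt {Fq : Type*} (Fqn : Type*) [Field Fq] [Fintype Fq] [Field Fqn]
    [Algebra Fq Fqn] (f : Polynomial Fq) : Polynomial Fqn :=
  f.sum fun i a => C (algebraMap Fq Fqn a) * X ^ (Fintype.card Fq) ^ i

theorem eval_LqPolyExt {Fq Fqn : Type*} [Field Fq] [Fintype Fq] [Field Fqn] [Algebra Fq Fqn]
    (f : Polynomial Fq) (y : Fqn) : (LqPolyExt Fqn f).eval y = Lq f y := by
  simp [LqPolyExt, Lq, Polynomial.sum, eval_finsetSum]

theorem Lq_mul {Fq Fqn : Type*} [Field Fq] [Fintype Fq] [Field Fqn] [Algebra Fq Fqn]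
    (f g : Polynomial Fq) (y : Fqn) : Lq (f * g) y = Lq f (Lq g y) := by
  simp [Lq_eq_aeval_frobenius]

theorem Lq_eq_self_of_dvd {Fq Fqn : Type*} [Field Fq] [Fintype Fq] [Field Fqn] [Algebra Fq Fqn]
    [FiniteDimensional Fq Fqn] {g : Polynomial Fq}
    (hg : (X ^ Module.finrank Fq Fqn - 1 : Polynomial Fq) ∣ g - 1) (y : Fqn) : Lq g y = y := by
  have : Finite Fqn := Module.finite_of_finite Fq
  have hX := minpoly.aeval Fq (FiniteField.frobeniusAlgHom Fq Fqn).toLinearMap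
  rw [FiniteField.minpoly_frobeniusAlgHom] at hX
  obtain ⟨u, hu⟩ := hg
  rw [Lq_eq_aeval_frobenius, eq_add_of_sub_eq hu, map_add, map_mul, hX]
  simp

theorem trace_Lq {Fq Fqn : Type*} [Field Fq] [Fintype Fq] [Field Fqn] [Algebra Fq Fqn]
    [FiniteDimensional Fq Fqn] (f : Polynomial Fq) (y : Fqn) :
    Algebra.trace Fq Fqn (Lq f y) = f.eval 1 * Algebra.trace Fq Fqn y := by
  have hfrob (z : Fqn) :
      Algebra.trace Fq Fqn (z ^ Fintype.card Fq) = Algebra.trace Fq Fqn z :=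
    Algebra.trace_eq_of_algEquiv (FiniteField.frobeniusAlgEquivOfAlgebraic Fq Fqn) z
  have hpow (i : ℕ) (z : Fqn) :
      Algebra.trace Fq Fqn (z ^ Fintype.card Fq ^ i) = Algebra.trace Fq Fqn z := by
    induction i with
    | zero => simp
    | succ i ih => rw [pow_succ, pow_mul, hfrob, ih]
  simp only [Lq, Polynomial.sum, map_sum, ← Algebra.smul_def, map_smul, hpow, eval_eq_sum,
    one_pow, mul_one, Finset.sum_mul, smul_eq_mul]

theorem trace_eval_algebraMap {Fq Fqn : Type*} [Field Fq] [Field Fqn] [Algebra Fq Fqn]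
    (f : Polynomial Fqn) (c : Fq) :
    Algebra.trace Fq Fqn (f.eval (algebraMap Fq Fqn c)) = (Tn Fq f).eval c := by
  rw [eval_eq_sum]
  simp only [Tn, Polynomial.sum, map_sum, eval_finsetSum, eval_mul, eval_C, eval_pow, eval_X]
  refine Finset.sum_congr rfl fun i _ => ?_
  rw [← map_pow, mul_comm, ← Algebra.smul_def, map_smul, smul_eq_mul, mul_comm]

/-- **Compositional inverse, case `p ∣ n`.** Suppose `p ∣ n`, `h, k ∈ 𝔽_q[x]` with
`k(c) ≠ 0` for all `c ∈ 𝔽_q` and `gcd(h, xⁿ-1) = 1`, and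
`P(x) = f(Tr(x)) + k(Tr(x))·L_h(x)` is a PP of `𝔽_{qⁿ}`. Let `R` invert
`Q(x) = T_n[f](x) + k(x)·h(1)·x` on `𝔽_q`, let `H` have degree `≤ n-1` with
`h·H ≡ 1 (mod xⁿ-1)`, and let `F ≡ -k(R(x))^{q-2}·L_H(f(R(x))) (mod x^q - x)`. Then
`P₀(x) = F(Tr(x)) + k(R(Tr(x)))^{q-2}·L_H(x)` satisfies `P₀(P(a)) = a` for all
`a ∈ 𝔽_{qⁿ}`. -/
theorem trace_inverse_PP_of_char_dvd {Fq Fqn : Type*} [Field Fq] [Fintype Fq] [DecidableEq Fq]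
    [Field Fqn] [Algebra Fq Fqn]
    {n : ℕ} (hn : 0 < n) (hrank : Module.finrank Fq Fqn = n)
    (hpn : ringChar Fq ∣ n)
    (h k : Polynomial Fq) (hk : ∀ c : Fq, k.eval c ≠ 0)
    (hgcd : gcd h (X ^ n - 1 : Polynomial Fq) = 1)
    (f : Polynomial Fqn)
    (P : Fqn → Fqn)
    (hP : P = fun x : Fqn =>
      f.eval (algebraMap Fq Fqn (Algebra.trace Fq Fqn x)) +
        algebraMap Fq Fqn (k.eval (Algebra.trace Fq Fqn x)) * Lq h x)
    (hPbij : Function.Bijective P)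
    (R : Polynomial Fq)
    (hR : ∀ c : Fq, R.eval ((Tn Fq f + k * C (h.eval 1) * X : Polynomial Fq).eval c) = c)
    (H : Polynomial Fq) (hHdeg : H.natDegree ≤ n - 1)
    (hH : (X ^ n - 1 : Polynomial Fq) ∣ h * H - 1)
    (F : Polynomial Fqn)
    (hF : (X ^ Fintype.card Fq - X : Polynomial Fqn) ∣
      F - (-(((k.comp R).map (algebraMap Fq Fqn)) ^ (Fintype.card Fq - 2) *
        (LqPolyExt Fqn H).comp (f.comp (R.map (algebraMap Fq Fqn))))) ) :
    ∀ a : Fqn,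
      F.eval (algebraMap Fq Fqn (Algebra.trace Fq Fqn (P a))) +
        algebraMap Fq Fqn (k.eval (R.eval (Algebra.trace Fq Fqn (P a)))) ^
            (Fintype.card Fq - 2) * Lq H (P a) = a := by
  intro a
  have : FiniteDimensional Fq Fqn := Module.finite_of_finrank_pos (hrank ▸ hn)
  subst hrank hP
  dsimp only
  set t := Algebra.trace Fq Fqn a with ht
  have htrace : Algebra.trace Fq Fqn (f.eval (algebraMap Fq Fqn t) +
      algebraMap Fq Fqn (k.eval t) * Lq h a) =
      (Tn Fq f + k * C (h.eval 1) * X : Polynomial Fq).eval t := by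
    rw [map_add, ← Algebra.smul_def, map_smul, trace_Lq, trace_eval_algebraMap, smul_eq_mul]
    simp [ht, mul_assoc]
  rw [htrace]
  have hRt := hR t
  set c := (Tn Fq f + k * C (h.eval 1) * X : Polynomial Fq).eval t
  have hFc : F.eval (algebraMap Fq Fqn c) =
      -(algebraMap Fq Fqn (k.eval t) ^ (Fintype.card Fq - 2) *
        Lq H (f.eval (algebraMap Fq Fqn t))) := by
    obtain ⟨u, hu⟩ := hF
    have hc := congrArg (eval (algebraMap Fq Fqn c)) hu
    have hzero : algebraMap Fq Fqn c ^ Fintype.card Fq - algebraMap Fq Fqn c = 0 := by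
      rw [← map_pow, FiniteField.pow_card, sub_self]
    simp only [eval_sub, eval_mul, eval_neg, eval_pow, eval_X, eval_comp, eval_LqPolyExt,
      eval_map_apply, hRt, hzero, zero_mul] at hc
    exact sub_eq_zero.mp hc
  have hLH : Lq H (f.eval (algebraMap Fq Fqn t) + algebraMap Fq Fqn (k.eval t) * Lq h a) =
      Lq H (f.eval (algebraMap Fq Fqn t)) + algebraMap Fq Fqn (k.eval t) * a := by
    have hinv : Lq H (Lq h a) = a := by
      rw [← Lq_mul, mul_comm]
      exact Lq_eq_self_of_dvd hH a
    simp only [Lq_eq_aeval_frobenius, ← Algebra.smul_def, map_add, map_smul] at hinv ⊢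
    rw [hinv]
  have hkpow : k.eval t ^ (Fintype.card Fq - 2) * k.eval t = 1 := by
    have hq := Fintype.one_lt_card (α := Fq)
    rw [← pow_succ, show Fintype.card Fq - 2 + 1 = Fintype.card Fq - 1 by omega]
    exact FiniteField.pow_card_sub_one_eq_one _ (hk t)
  rw [hRt, hFc, hLH, mul_add, neg_add_cancel_left, ← mul_assoc, ← map_pow, ← map_mul, hkpow,
    map_one, one_mul]
end

section
/- Let f, h, k ∈ F_q[x] with k(c) ∈ F_q \ {0} for every c ∈ F_q. Then P(x) = f(Tr_{q^n/q}(x)) + k(Tr_{q^n/q}(x))·L_h(x) is a permutation polynomial of F_{q^n} if and only if gcd(h(x), (x^n − 1)/(x − 1)) = 1 in F_q[x] and Q(x) = n·f(x) + h(1)·k(x)·x is a permutation polynomial of F_q. -/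
open Polynomial

open FiniteField

/-- A divisor of the minimal polynomial of an endomorphism which acts injectively is a unit. -/
theorem isUnit_of_dvd_minpoly_of_aeval_injective {K V : Type*} [Field K] [AddCommGroup V]
    [Module K V] [FiniteDimensional K V] (φ : Module.End K V) {g : K[X]} (hg : g ∣ minpoly K φ)
    (hinj : ∀ z, aeval φ g z = 0 → z = 0) : IsUnit g := by
  obtain ⟨m, hm⟩ := hg
  have hne : minpoly K φ ≠ 0 := minpoly.ne_zero (Algebra.IsIntegral.isIntegral φ)
  have hm0 : m ≠ 0 := by
    rintro rfl
    exact hne (by simpa using hm)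
  have hmφ : aeval φ m = 0 := by
    ext z
    refine hinj _ ?_
    rw [← Module.End.mul_apply, ← map_mul, ← hm, minpoly.aeval, LinearMap.zero_apply]
  obtain ⟨r, hr⟩ := minpoly.dvd K φ hmφ
  refine IsUnit.of_mul_eq_one r (mul_right_cancel₀ hm0 ?_)
  rw [one_mul]
  nth_rewrite 2 [hr]
  rw [hm]
  ring

section Frobenius

variable {Fq Fqn : Type*} [Field Fq] [Fintype Fq] [Field Fqn] [Algebra Fq Fqn]

theorem frobeniusAlgHom_toLinearMap_pow_apply (i : ℕ) (x : Fqn) :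
    ((frobeniusAlgHom Fq Fqn).toLinearMap ^ i) x = x ^ Fintype.card Fq ^ i := by
  induction i with
  | zero => simp
  | succ i ih =>
    rw [pow_succ', Module.End.mul_apply, ih, AlgHom.toLinearMap_apply, coe_frobeniusAlgHom,
      pow_succ, pow_mul]

/-- `L_h` is the value of `h` at the Frobenius endomorphism. -/
theorem Lq_eq_aeval_frobenius_s12 (h : Fq[X]) (x : Fqn) :
    Lq h x = aeval (frobeniusAlgHom Fq Fqn).toLinearMap h x := by
  rw [Lq, aeval_eq_sum_range, Polynomial.sum_over_range _ (by simp), LinearMap.sum_apply]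
  refine Finset.sum_congr rfl fun i _ => ?_
  rw [LinearMap.smul_apply, frobeniusAlgHom_toLinearMap_pow_apply, Algebra.smul_def]

variable [FiniteDimensional Fq Fqn]

theorem algebraMap_trace_eq_aeval_frobenius (x : Fqn) :
    algebraMap Fq Fqn (Algebra.trace Fq Fqn x) =
      aeval (frobeniusAlgHom Fq Fqn).toLinearMap
        (∑ i ∈ Finset.range (Module.finrank Fq Fqn), (X : Fq[X]) ^ i) x := by
  have : Finite Fqn := Module.finite_of_finite Fq
  simp [algebraMap_trace_eq_sum_pow, LinearMap.sum_apply, frobeniusAlgHom_toLinearMap_pow_apply]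

theorem trace_pow_card_pow (i : ℕ) (x : Fqn) :
    Algebra.trace Fq Fqn (x ^ Fintype.card Fq ^ i) = Algebra.trace Fq Fqn x := by
  induction i with
  | zero => simp
  | succ i ih =>
    rw [pow_succ, pow_mul, ← ih]
    exact Algebra.trace_eq_of_algEquiv (frobeniusAlgEquivOfAlgebraic Fq Fqn) _

theorem trace_Lq_s12 (h : Fq[X]) (x : Fqn) :
    Algebra.trace Fq Fqn (Lq h x) = h.eval 1 * Algebra.trace Fq Fqn x := by
  rw [Lq, Polynomial.sum_def, map_sum, eval_eq_sum, Polynomial.sum_def, Finset.sum_mul]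
  refine Finset.sum_congr rfl fun i _ => ?_
  rw [← Algebra.smul_def, map_smul, trace_pow_card_pow, smul_eq_mul, one_pow, mul_one]

end Frobenius

theorem X_pow_sub_one_div_X_sub_one {K : Type*} [Field K] (n : ℕ) :
    ((X ^ n - 1) / (X - 1) : K[X]) = ∑ i ∈ Finset.range n, X ^ i := by
  rw [← geom_sum_mul]
  exact mul_div_cancel_right₀ _ (X_sub_C_ne_zero (1 : K))

/-- Let `f, h, k ∈ 𝔽_q[x]` with `k(c) ≠ 0` for all `c ∈ 𝔽_q`. Then
`P(x) = f(Tr(x)) + k(Tr(x))·L_h(x)` is a PP of `𝔽_{qⁿ}` iff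
`gcd(h, (xⁿ-1)/(x-1)) = 1` in `𝔽_q[x]` and `Q(x) = n·f(x) + h(1)·k(x)·x`
is a PP of `𝔽_q`. -/
theorem trace_PP_iff_base_coeffs {Fq Fqn : Type*} [Field Fq] [Fintype Fq] [DecidableEq Fq]
    [Field Fqn] [Algebra Fq Fqn]
    {n : ℕ} (hn : 0 < n) (hrank : Module.finrank Fq Fqn = n)
    (f h k : Polynomial Fq) (hk : ∀ c : Fq, k.eval c ≠ 0) :
    Function.Bijective (fun x : Fqn =>
        algebraMap Fq Fqn (f.eval (Algebra.trace Fq Fqn x)) +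
          algebraMap Fq Fqn (k.eval (Algebra.trace Fq Fqn x)) * Lq h x) ↔
      (gcd h ((X ^ n - 1) / (X - 1) : Polynomial Fq) = 1 ∧
        Function.Bijective fun c : Fq => (n : Fq) * f.eval c + h.eval 1 * k.eval c * c) := by
  subst hrank
  have : FiniteDimensional Fq Fqn := Module.finite_of_finrank_pos hn
  have : Finite Fqn := Module.finite_of_finite Fq
  rw [X_pow_sub_one_div_X_sub_one]
  set S : Fq[X] := ∑ i ∈ Finset.range (Module.finrank Fq Fqn), X ^ i
  set φ := (frobeniusAlgHom Fq Fqn).toLinearMap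
  set P : Fqn → Fqn := fun x => algebraMap Fq Fqn (f.eval (Algebra.trace Fq Fqn x)) +
    algebraMap Fq Fqn (k.eval (Algebra.trace Fq Fqn x)) * Lq h x with hP
  set Q : Fq → Fq := fun c =>
    (Module.finrank Fq Fqn : Fq) * f.eval c + h.eval 1 * k.eval c * c with hQ
  have htrace (x : Fqn) : algebraMap Fq Fqn (Algebra.trace Fq Fqn x) = aeval φ S x :=
    algebraMap_trace_eq_aeval_frobenius x
  have hcomm (x : Fqn) : Algebra.trace Fq Fqn (P x) = Q (Algebra.trace Fq Fqn x) := by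
    simp only [hP, hQ]
    rw [map_add, Algebra.trace_algebraMap, ← Algebra.smul_def, map_smul, trace_Lq_s12, smul_eq_mul,
      nsmul_eq_mul]
    ring
  constructor
  · intro hbij
    refine ⟨?_, Function.Surjective.bijective_of_finite fun c => ?_⟩
    · rw [← normalize_gcd, normalize_eq_one]
      refine isUnit_of_dvd_minpoly_of_aeval_injective φ ?_ fun z hz => hbij.injective ?_
      · rw [minpoly_frobeniusAlgHom, ← geom_sum_mul]
        exact (gcd_dvd_right h S).mul_right _
      · have hzero {p : Fq[X]} (hp : gcd h S ∣ p) : aeval φ p z = 0 := by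
          obtain ⟨m, rfl⟩ := hp
          rw [mul_comm, map_mul, Module.End.mul_apply, hz, map_zero]
        have hz_trace : Algebra.trace Fq Fqn z = 0 :=
          (algebraMap Fq Fqn).injective
            (by rw [htrace, hzero (gcd_dvd_right h S), map_zero])
        simp only [hP]
        rw [hz_trace, map_zero, Lq_eq_aeval_frobenius_s12, Lq_eq_aeval_frobenius_s12, map_zero,
          hzero (gcd_dvd_left h S)]
    · obtain ⟨y, hy⟩ := Algebra.trace_surjective Fq Fqn c
      obtain ⟨x, rfl⟩ := hbij.surjective y
      exact ⟨Algebra.trace Fq Fqn x, by rw [← hcomm, hy]⟩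
  · rintro ⟨hgcd, hbij⟩
    refine Function.Injective.bijective_of_finite fun x y hxy => ?_
    have ht : Algebra.trace Fq Fqn x = Algebra.trace Fq Fqn y :=
      hbij.injective (by rw [← hcomm, ← hcomm, hxy])
    have hL : Lq h x = Lq h y := by
      simp only [hP, ht] at hxy
      exact mul_left_cancel₀ (by simpa using hk _) (add_left_cancel hxy)
    obtain ⟨a, b, hab⟩ := (gcd_isUnit_iff h S).mp (hgcd ▸ isUnit_one)
    have hh : aeval φ h (x - y) = 0 := by
      rw [map_sub, ← Lq_eq_aeval_frobenius_s12, ← Lq_eq_aeval_frobenius_s12, hL, sub_self]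
    have hSz : aeval φ S (x - y) = 0 := by
      rw [← htrace, map_sub, ht, sub_self, map_zero]
    have hone := congrArg (fun p => aeval φ p (x - y)) hab
    beta_reduce at hone
    rw [map_add, map_mul, map_mul, LinearMap.add_apply, Module.End.mul_apply,
      Module.End.mul_apply, hh, hSz, map_zero, map_zero, add_zero, map_one,
      Module.End.one_apply] at hone
    exact sub_eq_zero.mp hone.symm
end
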